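/- Let (u_{p_n}) be least energy solutions of the Finsler Lane-Emden problem with p_n → ∞, set v_n = u_{p_n}/(∫_Ω u_{p_n}^{p_n} dx)^{1/(N-1)}, and suppose that (along a subsequence, still denoted by n) the blow-up set S of (v_n) satisfies S ∩ Ω = {x_1, …, x_k}, a finite set. Then for every compact set K ⊂ Ω ∖ {x_1, …, x_k} one has ‖u_{p_n}‖_{L^∞(K)} → 0 as n → ∞. -/

import Mathlib

open MeasureTheory Filter Real Set
open scoped RealInnerProductSpace Topology NNReal

noncomputable section

abbrev Euc (N : ℕ) := EuclideanSpace ℝ (Fin N)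

/-- `H` is a norm on `ℝ^N`: convex, nonnegative, vanishing exactly at `0`,
and absolutely homogeneous. -/
def IsFinslerNorm (N : ℕ) (H : Euc N → ℝ) : Prop :=
  ConvexOn ℝ Set.univ H ∧
  (∀ ξ, 0 ≤ H ξ) ∧
  (∀ ξ, H ξ = 0 ↔ ξ = 0) ∧
  (∀ (t : ℝ) (ξ : Euc N), H (t • ξ) = |t| * H ξ)

/-- Regularity assumptions: `H ∈ C²(ℝ^N \ {0})`, `H^N ∈ C¹(ℝ^N)`, and the Hessian of
`H^N` is positive definite away from the origin. -/
def FinslerRegular (N : ℕ) (H : Euc N → ℝ) : Prop :=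
  ContDiffOn ℝ 2 H {(0 : Euc N)}ᶜ ∧
  ContDiff ℝ 1 (fun ξ => H ξ ^ N) ∧
  ∀ ξ : Euc N, ξ ≠ 0 → ∀ v : Euc N, v ≠ 0 →
    0 < iteratedFDeriv ℝ 2 (fun ξ => H ξ ^ N) ξ ![v, v]

/-- The dual norm `H⁰(x) = sup_{ξ ≠ 0} ⟪x, ξ⟫ / H(ξ)`. -/
def dualNorm {N : ℕ} (H : Euc N → ℝ) (x : Euc N) : ℝ :=
  sSup {r : ℝ | ∃ ξ : Euc N, ξ ≠ 0 ∧ r = ⟪x, ξ⟫ / H ξ}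

/-- `κ_N`, the volume of the Wulff ball `{H⁰ < 1}`. -/
def wulffVol (N : ℕ) (H : Euc N → ℝ) : ℝ :=
  (volume {x : Euc N | dualNorm H x < 1}).toReal

/-- `β_N = N (N κ_N)^{1/(N-1)}`. -/
def betaN (N : ℕ) (H : Euc N → ℝ) : ℝ :=
  N * (N * wulffVol N H) ^ ((1 : ℝ) / ((N : ℝ) - 1))

/-- `u` is a weak solution of `-Q_N u = g` on the open set `U`:
`∫_U H(∇u)^{N-1} ⟪∇H(∇u), ∇φ⟫ = ∫_U g φ` for all test functions `φ`. -/
def IsWeakSolution (N : ℕ) (H : Euc N → ℝ) (U : Set (Euc N)) (u g : Euc N → ℝ) : Prop :=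
  ∀ φ : Euc N → ℝ, ContDiff ℝ (⊤ : ℕ∞) φ → HasCompactSupport φ → tsupport φ ⊆ U →
    (∫ x in U, H (gradient u x) ^ (N - 1) * ⟪gradient H (gradient u x), gradient φ x⟫)
      = ∫ x in U, g x * φ x

/-- `C_p`, the infimum of `∫_Ω H(∇u)^N` over test functions normalized in `L^{p+1}`. -/
def energyInf (N : ℕ) (H : Euc N → ℝ) (Ω : Set (Euc N)) (p : ℝ) : ℝ :=
  sInf {c : ℝ | ∃ u : Euc N → ℝ, ContDiff ℝ (⊤ : ℕ∞) u ∧ HasCompactSupport u ∧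
    tsupport u ⊆ Ω ∧ (∫ x in Ω, |u x| ^ (p + 1)) = 1 ∧
    c = ∫ x in Ω, H (gradient u x) ^ N}

/-- A least energy solution of the Finsler Lane–Emden problem on `Ω` with exponent `p`. -/
def IsLeastEnergySolution (N : ℕ) (H : Euc N → ℝ) (Ω : Set (Euc N)) (p : ℝ)
    (u : Euc N → ℝ) : Prop :=
  ContDiffOn ℝ 1 u (closure Ω) ∧
  (∀ x ∈ Ω, 0 < u x) ∧
  (∀ x ∈ frontier Ω, u x = 0) ∧
  IsWeakSolution N H Ω u (fun x => u x ^ p) ∧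
  (∫ x in Ω, H (gradient u x) ^ N)
    = energyInf N H Ω p * (∫ x in Ω, u x ^ (p + 1)) ^ ((N : ℝ) / (p + 1))

/-- The blow-up set of a sequence of functions `v n` on `Ω`. -/
def BlowUpSet {N : ℕ} (Ω : Set (Euc N)) (v : ℕ → Euc N → ℝ) : Set (Euc N) :=
  {x | x ∈ closure Ω ∧ ∃ σ : ℕ → ℕ, StrictMono σ ∧ ∃ xs : ℕ → Euc N,
    (∀ n, xs n ∈ Ω) ∧ Tendsto xs atTop (𝓝 x) ∧
    Tendsto (fun n => v (σ n) (xs n)) atTop atTop}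

/-! ### Facts about the Finsler norm -/

theorem FinslerRegular.continuous {N : ℕ} {H : Euc N → ℝ} (hN : N ≠ 0)
    (hnorm : IsFinslerNorm N H) (hreg : FinslerRegular N H) : Continuous H := by
  have h : H = fun ξ => (H ξ ^ N) ^ ((N : ℝ)⁻¹) := by
    funext ξ
    rw [Real.pow_rpow_inv_natCast (hnorm.2.1 ξ) hN]
  rw [h]
  exact hreg.2.1.continuous.rpow_const fun _ => Or.inr (by positivity)

theorem IsFinslerNorm.exists_le_mul_norm {N : ℕ} {H : Euc N → ℝ} (hnorm : IsFinslerNorm N H)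
    (hcont : Continuous H) : ∃ C : ℝ, 0 ≤ C ∧ ∀ ξ, H ξ ≤ C * ‖ξ‖ := by
  obtain ⟨C, hC⟩ := (isCompact_closedBall (0 : Euc N) 1).exists_bound_of_continuousOn
    hcont.continuousOn
  refine ⟨C, (norm_nonneg _).trans (hC 0 (by simp)), fun ξ => ?_⟩
  rcases eq_or_ne ξ 0 with rfl | hξ
  · simp [(hnorm.2.2.1 0).2 rfl]
  have hpos : 0 < ‖ξ‖ := norm_pos_iff.2 hξ
  have h1 := hC (‖ξ‖⁻¹ • ξ) (by simp [norm_smul, hpos.ne'])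
  rw [hnorm.2.2.2, abs_of_pos (inv_pos.2 hpos)] at h1
  have h2 := (le_abs_self _).trans h1
  rwa [inv_mul_le_iff₀ hpos, mul_comm] at h2

/-- The flux `H^{N-1} ∇H` is `N⁻¹ ∇(H^N)`, also at the origin. -/
theorem finsler_flux_eq {N : ℕ} {H : Euc N → ℝ} (hN : 2 ≤ N)
    (hnorm : IsFinslerNorm N H) (hreg : FinslerRegular N H) (ξ w : Euc N) :
    H ξ ^ (N - 1) * ⟪gradient H ξ, w⟫ = (N : ℝ)⁻¹ * fderiv ℝ (fun ξ => H ξ ^ N) ξ w := by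
  have hN0 : (N : ℝ) ≠ 0 := by positivity
  rcases eq_or_ne ξ 0 with rfl | hξ
  · have h0 : H 0 = 0 := (hnorm.2.2.1 0).2 rfl
    have hmin : IsLocalMin (fun ξ => H ξ ^ N) (0 : Euc N) :=
      Filter.Eventually.of_forall fun y => by
        simp only [h0, zero_pow (by lia : N ≠ 0)]
        exact pow_nonneg (hnorm.2.1 y) _
    rw [hmin.fderiv_eq_zero, h0, zero_pow (by lia)]
    simp
  · have hd : DifferentiableAt ℝ H ξ :=
      (hreg.1.contDiffAt (isOpen_compl_singleton.mem_nhds hξ)).differentiableAt (by norm_num)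
    rw [fderiv_fun_pow N hd, inner_gradient_left]
    simp
    field_simp

theorem finsler_euler {N : ℕ} {H : Euc N → ℝ}
    (hnorm : IsFinslerNorm N H) (hreg : FinslerRegular N H) (ξ : Euc N) :
    fderiv ℝ (fun ξ => H ξ ^ N) ξ ξ = N * H ξ ^ N := by
  have hd : HasFDerivAt (fun ξ => H ξ ^ N) (fderiv ℝ (fun ξ => H ξ ^ N) ((1 : ℝ) • ξ))
      ((1 : ℝ) • ξ) := (hreg.2.1.differentiable one_ne_zero _).hasFDerivAt
  have hs : HasDerivAt (fun t : ℝ => t • ξ) ((1 : ℝ) • ξ) 1 := (hasDerivAt_id (1 : ℝ)).smul_const ξ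
  have h1 : HasDerivAt (fun t : ℝ => H (t • ξ) ^ N)
      (fderiv ℝ (fun ξ => H ξ ^ N) ((1 : ℝ) • ξ) ((1 : ℝ) • ξ)) 1 :=
    (hd.comp_hasDerivAt (1 : ℝ) hs :)
  have h2 : HasDerivAt (fun t : ℝ => t ^ N * H ξ ^ N) (N * 1 ^ (N - 1) * H ξ ^ N) 1 :=
    (hasDerivAt_pow N (1 : ℝ)).mul_const _
  have h3 : (fun t : ℝ => H (t • ξ) ^ N) =ᶠ[𝓝 1] fun t : ℝ => t ^ N * H ξ ^ N := by
    filter_upwards [lt_mem_nhds (zero_lt_one' ℝ)] with t ht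
    rw [hnorm.2.2.2, abs_of_pos ht, mul_pow]
  have h4 := (h2.congr_of_eventuallyEq h3).unique h1
  simpa using h4.symm

/-! ### Approximation of compactly supported `C¹` functions -/

theorem exists_smooth_approx {N : ℕ} {U : Set (Euc N)} (hU : IsOpen U) {φ : Euc N → ℝ}
    (hφ : ContDiff ℝ 1 φ) (hc : HasCompactSupport φ) (hs : tsupport φ ⊆ U) {η : ℝ} (hη : 0 < η) :
    ∃ ψ : Euc N → ℝ, ContDiff ℝ (⊤ : ℕ∞) ψ ∧ HasCompactSupport ψ ∧ tsupport ψ ⊆ U ∧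
      ∀ x, |ψ x - φ x| ≤ η ∧ ‖fderiv ℝ ψ x - fderiv ℝ φ x‖ ≤ η := by
  have hφ' : Continuous (fderiv ℝ φ) := hφ.continuous_fderiv one_ne_zero
  obtain ⟨δ₁, hδ₁, h₁⟩ := Metric.uniformContinuous_iff.1
    (hc.uniformContinuous_of_continuous hφ.continuous) η hη
  obtain ⟨δ₂, hδ₂, h₂⟩ := Metric.uniformContinuous_iff.1
    ((hc.fderiv ℝ).uniformContinuous_of_continuous hφ') η hη
  obtain ⟨δ₃, hδ₃, h₃⟩ := hc.isCompact.exists_cthickening_subset_open hU hs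
  set δ := min δ₁ (min δ₂ δ₃) with hδdef
  have hδ : 0 < δ := lt_min hδ₁ (lt_min hδ₂ hδ₃)
  let f : ContDiffBump (0 : Euc N) := ⟨δ / 2, δ, half_pos hδ, half_lt_self hδ⟩
  let L := ContinuousLinearMap.lsmul ℝ ℝ (E := ℝ)
  have hloc : LocallyIntegrable (f.normed volume) :=
    f.continuous_normed.locallyIntegrable
  have hsupp : Function.support (convolution (f.normed volume) φ L volume) ⊆
      Metric.cthickening δ₃ (tsupport φ) := by
    intro x hx
    obtain ⟨y, hy, z, hz, rfl⟩ := support_convolution_subset L hx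
    rw [f.support_normed_eq, mem_ball_zero_iff] at hy
    refine Metric.mem_cthickening_of_dist_le _ z δ₃ _ (subset_tsupport _ hz) ?_
    rw [dist_eq_norm, add_sub_cancel_right]
    exact hy.le.trans ((min_le_right _ _).trans (min_le_right _ _))
  have htsupp : tsupport (convolution (f.normed volume) φ L volume) ⊆
      Metric.cthickening δ₃ (tsupport φ) :=
    closure_minimal hsupp Metric.isClosed_cthickening
  refine ⟨convolution (f.normed volume) φ L volume, ?_, ?_, htsupp.trans h₃, fun x => ⟨?_, ?_⟩⟩
  · exact f.hasCompactSupport_normed.contDiff_convolution_left L f.contDiff_normed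
      hφ.continuous.locallyIntegrable
  · exact (hc.isCompact.cthickening).of_isClosed_subset (isClosed_tsupport _) htsupp
  · rw [← Real.dist_eq]
    refine f.dist_normed_convolution_le hφ.continuous.aestronglyMeasurable fun y hy => ?_
    exact (h₁ (lt_of_lt_of_le (Metric.mem_ball.1 hy) (min_le_left _ _))).le
  · rw [(hc.hasFDerivAt_convolution_right L hloc hφ x).fderiv, ← dist_eq_norm]
    have hL : L.precompR (Euc N) = ContinuousLinearMap.lsmul ℝ ℝ (E := Euc N →L[ℝ] ℝ) := by
      ext; rfl
    rw [hL]
    refine f.dist_normed_convolution_le hφ'.aestronglyMeasurable fun y hy => ?_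
    exact (h₂ (lt_of_lt_of_le (Metric.mem_ball.1 hy)
      ((min_le_right _ _).trans (min_le_left _ _)))).le

/-! ### Testing the equation with the solution itself -/

theorem integrableOn_of_continuousOn_of_bounded {N : ℕ} {U : Set (Euc N)} (hU : IsOpen U)
    (hUb : Bornology.IsBounded U) {f : Euc N → ℝ} (hf : ContinuousOn f U) {C : ℝ}
    (hC : ∀ x ∈ U, |f x| ≤ C) : IntegrableOn f U :=
  ⟨hf.aestronglyMeasurable hU.measurableSet, .restrict_of_bounded C hUb.measure_lt_top
    ((ae_restrict_iff' hU.measurableSet).2 (Filter.Eventually.of_forall hC))⟩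

theorem gradient_eq_toDual_symm {N : ℕ} (u : Euc N → ℝ) (x : Euc N) :
    gradient u x = (InnerProductSpace.toDual ℝ (Euc N)).symm (fderiv ℝ u x) := rfl

theorem norm_gradient {N : ℕ} (u : Euc N → ℝ) (x : Euc N) :
    ‖gradient u x‖ = ‖fderiv ℝ u x‖ := by
  rw [gradient_eq_toDual_symm, LinearIsometryEquiv.norm_map]

theorem continuousOn_gradient {N : ℕ} {U : Set (Euc N)} (hU : IsOpen U) {u : Euc N → ℝ}
    (hu : ContDiffOn ℝ 1 u U) : ContinuousOn (gradient u) U :=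
  (LinearIsometryEquiv.continuous _).comp_continuousOn
    (hu.continuousOn_fderiv_of_isOpen hU le_rfl)

/-- The weak formulation extends to `C¹` test functions with compact support. -/
theorem IsWeakSolution.eq_of_contDiff_one {N : ℕ} {H : Euc N → ℝ} (hN : 2 ≤ N)
    (hnorm : IsFinslerNorm N H) (hreg : FinslerRegular N H) {U : Set (Euc N)} (hU : IsOpen U)
    (hUb : Bornology.IsBounded U) {u g : Euc N → ℝ} (hw : IsWeakSolution N H U u g)
    (hg : IntegrableOn g U) (hu : ContDiffOn ℝ 1 u U) {B : ℝ}
    (hB : ∀ x ∈ U, ‖fderiv ℝ u x‖ ≤ B) {φ : Euc N → ℝ} (hφ : ContDiff ℝ 1 φ)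
    (hc : HasCompactSupport φ) (hs : tsupport φ ⊆ U) :
    ∫ x in U, (N : ℝ)⁻¹ * fderiv ℝ (fun ξ => H ξ ^ N) (gradient u x) (gradient φ x) =
      ∫ x in U, g x * φ x := by
  let P : Euc N → Euc N →L[ℝ] ℝ := fun ξ => (N : ℝ)⁻¹ • fderiv ℝ (fun ξ => H ξ ^ N) ξ
  have hP : Continuous P := (hreg.2.1.continuous_fderiv one_ne_zero).const_smul (N : ℝ)⁻¹
  obtain ⟨M, hM⟩ := (isCompact_closedBall (0 : Euc N) B).exists_bound_of_continuousOn
    hP.continuousOn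
  have hPM : ∀ x ∈ U, ‖P (gradient u x)‖ ≤ M := fun x hx =>
    hM _ (by simpa [norm_gradient] using hB x hx)
  have hPc : ContinuousOn (fun x => P (gradient u x)) U :=
    hP.comp_continuousOn (continuousOn_gradient hU hu)
  have hint : ∀ ψ : Euc N → ℝ, ContDiff ℝ 1 ψ → HasCompactSupport ψ →
      IntegrableOn (fun x => P (gradient u x) (gradient ψ x)) U ∧
      IntegrableOn (fun x => g x * ψ x) U := by
    intro ψ hψ hψc
    obtain ⟨D, hD⟩ := (hψc.fderiv ℝ).exists_bound_of_continuous
      (hψ.continuous_fderiv one_ne_zero)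
    obtain ⟨D', hD'⟩ := hψc.exists_bound_of_continuous hψ.continuous
    refine ⟨integrableOn_of_continuousOn_of_bounded hU hUb (C := M * D)
      (hPc.clm_apply (continuousOn_gradient hU hψ.contDiffOn)) fun x hx => ?_, ?_⟩
    · refine ((P (gradient u x)).le_opNorm _).trans ?_
      rw [norm_gradient]
      exact mul_le_mul (hPM x hx) (hD x) (norm_nonneg _) ((norm_nonneg _).trans (hPM x hx))
    · exact Integrable.mul_bdd (c := D') hg hψ.continuous.aestronglyMeasurable
        (Filter.Eventually.of_forall hD')
  set K := M * volume.real U + ∫ x in U, |g x| with hK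
  have key : ∀ η > 0, |(∫ x in U, P (gradient u x) (gradient φ x)) - ∫ x in U, g x * φ x|
      ≤ η * K := by
    intro η hη
    obtain ⟨ψ, hψ, hψc, hψs, hψη⟩ := exists_smooth_approx hU hφ hc hs hη
    have hψ1 : ContDiff ℝ 1 ψ := hψ.of_le (by exact_mod_cast le_top)
    have hweak : ∫ x in U, P (gradient u x) (gradient ψ x) = ∫ x in U, g x * ψ x := by
      rw [← hw ψ hψ hψc hψs]
      congr 1 with x
      rw [finsler_flux_eq hN hnorm hreg]
      rfl
    have e1 : |∫ x in U, (P (gradient u x) (gradient ψ x) - P (gradient u x) (gradient φ x))| ≤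
        (M * η) * volume.real U := by
      rw [← Real.norm_eq_abs]
      refine norm_setIntegral_le_of_norm_le_const (μ := volume) hUb.measure_lt_top fun x hx => ?_
      rw [← map_sub]
      refine ((P (gradient u x)).le_opNorm _).trans ?_
      refine mul_le_mul (hPM x hx) ?_ (norm_nonneg _) ((norm_nonneg _).trans (hPM x hx))
      rw [gradient_eq_toDual_symm, gradient_eq_toDual_symm, ← map_sub,
        LinearIsometryEquiv.norm_map]
      exact (hψη x).2
    have e2 : |∫ x in U, (g x * ψ x - g x * φ x)| ≤ η * ∫ x in U, |g x| := by
      rw [← integral_const_mul, ← Real.norm_eq_abs]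
      refine norm_integral_le_of_norm_le (hg.abs.const_mul η)
        (Filter.Eventually.of_forall fun x => ?_)
      rw [← mul_sub, norm_mul, mul_comm, Real.norm_eq_abs, Real.norm_eq_abs]
      exact mul_le_mul_of_nonneg_right (hψη x).1 (abs_nonneg _)
    rw [integral_sub (hint ψ hψ1 hψc).1 (hint φ hφ hc).1] at e1
    rw [integral_sub (hint ψ hψ1 hψc).2 (hint φ hφ hc).2] at e2
    have : (∫ x in U, P (gradient u x) (gradient φ x)) - ∫ x in U, g x * φ x =
        ((∫ x in U, g x * ψ x) - ∫ x in U, g x * φ x) -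
        ((∫ x in U, P (gradient u x) (gradient ψ x)) -
          ∫ x in U, P (gradient u x) (gradient φ x)) := by
      rw [hweak]; ring
    rw [this]
    refine (abs_sub _ _).trans ((add_le_add e2 e1).trans_eq ?_)
    rw [hK]; ring
  have hlim : Tendsto (fun η : ℝ => η * K) (𝓝[>] 0) (𝓝 0) := by
    have : Tendsto (fun η : ℝ => η * K) (𝓝 0) (𝓝 (0 * K)) := tendsto_id.mul_const K
    rw [zero_mul] at this
    exact this.mono_left nhdsWithin_le_nhds
  have h0 := ge_of_tendsto hlim (by filter_upwards [self_mem_nhdsWithin] with η hη using key η hη)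
  exact sub_eq_zero.1 (abs_eq_zero.1 (le_antisymm h0 (abs_nonneg _)))

theorem exists_soft_truncation {ε : ℝ} (hε : 0 < ε) :
    ∃ F r : ℝ → ℝ, Continuous r ∧ (∀ t, HasDerivAt F (r t) t) ∧ (∀ t, 0 ≤ r t) ∧
      (∀ t, r t ≤ 1) ∧ (∀ t, t ≤ ε → F t = 0) ∧ ∀ t, t - 2 * ε ≤ F t := by
  let r : ℝ → ℝ := fun s => min 1 (max 0 ((s - ε) / ε))
  have hr : Continuous r := by fun_prop
  have hr0 : ∀ t, 0 ≤ r t := fun t => le_min zero_le_one (le_max_left _ _)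
  have hz : ∀ t, t ≤ ε → ∫ s in ε..t, r s = 0 := by
    intro t ht
    refine intervalIntegral.integral_zero_ae (Filter.Eventually.of_forall fun s hs => ?_)
    rw [uIoc_of_ge ht] at hs
    have : (s - ε) / ε ≤ 0 := div_nonpos_of_nonpos_of_nonneg (by linarith [hs.2]) hε.le
    simp [r, max_eq_left this]
  refine ⟨fun t => ∫ s in ε..t, r s, r, hr, fun t => ?_, hr0, fun t => min_le_left _ _, hz, ?_⟩
  · exact intervalIntegral.integral_hasDerivAt_right (hr.intervalIntegrable _ _)
      (hr.stronglyMeasurableAtFilter _ _) hr.continuousAt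
  · intro t
    change t - 2 * ε ≤ ∫ s in ε..t, r s
    rcases le_total t ε with ht | ht
    · rw [hz t ht]; linarith
    rcases le_total t (2 * ε) with ht' | ht'
    · exact (by linarith : t - 2 * ε ≤ 0).trans
        (intervalIntegral.integral_nonneg ht fun s _ => hr0 s)
    · rw [← intervalIntegral.integral_add_adjacent_intervals (b := 2 * ε)
        (hr.intervalIntegrable _ _) (hr.intervalIntegrable _ _)]
      have h1 : ∫ s in (2 * ε)..t, r s = ∫ _ in (2 * ε)..t, (1 : ℝ) := by
        refine intervalIntegral.integral_congr fun s hs => ?_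
        rw [uIcc_of_le ht'] at hs
        have : 1 ≤ (s - ε) / ε := by rw [le_div_iff₀ hε]; linarith [hs.1]
        simp [r, this]
      rw [h1, intervalIntegral.integral_const, smul_eq_mul, mul_one]
      have h2 : 0 ≤ ∫ s in ε..(2 * ε), r s :=
        intervalIntegral.integral_nonneg (by linarith) fun s _ => hr0 s
      linarith

theorem exists_fderiv_bound {N : ℕ} {Ω : Set (Euc N)} (hΩo : IsOpen Ω)
    (hΩb : Bornology.IsBounded Ω) {u : Euc N → ℝ} (hu : ContDiffOn ℝ 1 u (closure Ω)) :
    ∃ B : ℝ, ∀ x ∈ Ω, ‖fderiv ℝ u x‖ ≤ B := by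
  have hcpt : IsCompact (closure Ω) := hΩb.isCompact_closure
  suffices h : ∃ B : ℝ, ∀ x ∈ closure Ω ∩ Ω, ‖fderiv ℝ u x‖ ≤ B by
    obtain ⟨B, hB⟩ := h
    exact ⟨B, fun x hx => hB x ⟨subset_closure hx, hx⟩⟩
  refine hcpt.induction_on (p := fun s => ∃ B : ℝ, ∀ x ∈ s ∩ Ω, ‖fderiv ℝ u x‖ ≤ B)
    ⟨0, by simp⟩ ?_ ?_ ?_
  · rintro s t hst ⟨B, hB⟩
    exact ⟨B, fun x hx => hB x ⟨hst hx.1, hx.2⟩⟩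
  · rintro s t ⟨B, hB⟩ ⟨C, hC⟩
    refine ⟨max B C, fun x hx => ?_⟩
    rcases hx.1 with h | h
    · exact (hB x ⟨h, hx.2⟩).trans (le_max_left _ _)
    · exact (hC x ⟨h, hx.2⟩).trans (le_max_right _ _)
  · intro x hx
    have h1 : ContDiffWithinAt ℝ (0 + 1) u (closure Ω) x := by simpa using hu x hx
    obtain ⟨w, hw, -, -, f', hf', hf'c⟩ :=
      (contDiffWithinAt_succ_iff_hasFDerivWithinAt' (by simp)).1 h1
    rw [insert_eq_of_mem hx] at hw
    have hb : ∀ᶠ y in 𝓝[closure Ω] x, ‖f' y‖ < ‖f' x‖ + 1 :=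
      hf'c.continuousWithinAt.norm.eventually_lt_const (lt_add_one _)
    refine ⟨_, inter_mem hw hb, ‖f' x‖ + 1, ?_⟩
    rintro y ⟨⟨hyw, hyb⟩, hyΩ⟩
    have hnhds : closure Ω ∈ 𝓝 y := mem_of_superset (hΩo.mem_nhds hyΩ) subset_closure
    rw [((hf' y hyw).hasFDerivAt hnhds).fderiv]
    exact le_of_lt hyb

/-- Testing the equation with (truncations of) the solution itself. -/
theorem integral_rpow_le_energy {N : ℕ} {H : Euc N → ℝ} (hN : 2 ≤ N)
    (hnorm : IsFinslerNorm N H) (hreg : FinslerRegular N H) {Ω : Set (Euc N)} (hΩo : IsOpen Ω)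
    (hΩb : Bornology.IsBounded Ω) {p : ℝ} (hp : 1 < p) {u : Euc N → ℝ}
    (hu : ContDiffOn ℝ 1 u (closure Ω)) (hpos : ∀ x ∈ Ω, 0 < u x)
    (hzero : ∀ x ∈ frontier Ω, u x = 0)
    (hw : IsWeakSolution N H Ω u (fun x => u x ^ p)) :
    ∫ x in Ω, u x ^ (p + 1) ≤ ∫ x in Ω, H (gradient u x) ^ N := by
  have hcpt : IsCompact (closure Ω) := hΩb.isCompact_closure
  have hN0 : (N : ℝ) ≠ 0 := by positivity
  obtain ⟨B, hB⟩ := exists_fderiv_bound hΩo hΩb hu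
  obtain ⟨M, hM⟩ := hcpt.exists_bound_of_continuousOn hu.continuousOn
  have huΩ : ContDiffOn ℝ 1 u Ω := hu.mono subset_closure
  have hMΩ : ∀ x ∈ Ω, u x ≤ M := fun x hx => (le_abs_self _).trans (hM x (subset_closure hx))
  have hpow : ∀ q : ℝ, 0 ≤ q → IntegrableOn (fun x => u x ^ q) Ω := by
    intro q hq
    refine integrableOn_of_continuousOn_of_bounded hΩo hΩb (C := M ^ q)
      (huΩ.continuousOn.rpow_const fun x hx => Or.inr hq) fun x hx => ?_
    rw [abs_of_nonneg (rpow_nonneg (hpos x hx).le _)]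
    exact rpow_le_rpow (hpos x hx).le (hMΩ x hx) hq
  have hHc := hreg.continuous (by lia) hnorm
  obtain ⟨C, hC⟩ := (isCompact_closedBall (0 : Euc N) B).exists_bound_of_continuousOn
    (hHc.pow N).continuousOn
  have hHb : ∀ x ∈ Ω, |H (gradient u x) ^ N| ≤ C := fun x hx =>
    hC _ (by simpa [norm_gradient] using hB x hx)
  have hHcont : ContinuousOn (fun x => H (gradient u x) ^ N) Ω :=
    (hHc.pow N).comp_continuousOn (continuousOn_gradient hΩo huΩ)
  have hHint : IntegrableOn (fun x => H (gradient u x) ^ N) Ω :=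
    integrableOn_of_continuousOn_of_bounded hΩo hΩb hHcont hHb
  have key : ∀ ε > 0, (∫ x in Ω, u x ^ (p + 1)) - 2 * ε * ∫ x in Ω, u x ^ p ≤
      ∫ x in Ω, H (gradient u x) ^ N := by
    intro ε hε
    obtain ⟨F, r, hr, hF, hr0, hr1, hFz, hFl⟩ := exists_soft_truncation hε
    have hF1 : ContDiff ℝ 1 F := by
      rw [contDiff_one_iff_deriv]
      refine ⟨fun t => (hF t).differentiableAt, ?_⟩
      rwa [show deriv F = r from funext fun t => (hF t).deriv]
    classical
    let φ : Euc N → ℝ := Ω.indicator fun x => F (u x)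
    set L : Set (Euc N) := closure Ω ∩ u ⁻¹' Ici ε with hL
    have hLclosed : IsClosed L :=
      hu.continuousOn.preimage_isClosed_of_isClosed isClosed_closure isClosed_Ici
    have hLΩ : L ⊆ Ω := by
      rintro x ⟨hx, hxε⟩
      by_contra hxΩ
      have h0 := hzero x (by rw [hΩo.frontier_eq]; exact ⟨hx, hxΩ⟩)
      rw [mem_preimage, h0] at hxε
      exact absurd hxε (not_le.2 hε)
    have hφL : ∀ x ∉ L, φ x = 0 := by
      intro x hx
      by_cases hxΩ : x ∈ Ω
      · rw [show φ x = F (u x) from indicator_of_mem hxΩ _]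
        refine hFz _ (le_of_not_ge fun h => hx ⟨subset_closure hxΩ, h⟩)
      · exact indicator_of_notMem hxΩ _
    have hφsupp : tsupport φ ⊆ L :=
      closure_minimal (fun x hx => by_contra fun h => hx (hφL x h)) hLclosed
    have hφΩ : ∀ x ∈ Ω, φ =ᶠ[𝓝 x] fun x => F (u x) := fun x hx => by
      filter_upwards [hΩo.mem_nhds hx] with y hy using indicator_of_mem hy _
    have hφ1 : ContDiff ℝ 1 φ := by
      rw [contDiff_iff_contDiffAt]
      intro x
      by_cases hx : x ∈ Ω
      · exact (hF1.contDiffAt.comp x (huΩ.contDiffAt (hΩo.mem_nhds hx))).congr_of_eventuallyEq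
          (hφΩ x hx)
      · have : φ =ᶠ[𝓝 x] fun _ => 0 := by
          filter_upwards [hLclosed.isOpen_compl.mem_nhds fun h => hx (hLΩ h)] with y hy
            using hφL y hy
        exact contDiffAt_const.congr_of_eventuallyEq this
    have hφc : HasCompactSupport φ :=
      (hcpt.of_isClosed_subset hLclosed inter_subset_left).of_isClosed_subset
        (isClosed_tsupport _) hφsupp
    have hgrad : ∀ x ∈ Ω, gradient φ x = r (u x) • gradient u x := by
      intro x hx
      have hdu : HasFDerivAt u (fderiv ℝ u x) x :=
        ((huΩ.contDiffAt (hΩo.mem_nhds hx)).differentiableAt one_ne_zero).hasFDerivAt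
      have := ((hF (u x)).comp_hasFDerivAt x hdu).congr_of_eventuallyEq (hφΩ x hx)
      rw [gradient_eq_toDual_symm, this.fderiv, map_smul, gradient_eq_toDual_symm]
    have htest := hw.eq_of_contDiff_one hN hnorm hreg hΩo hΩb (hpow p (by linarith)) huΩ hB hφ1
      hφc (hφsupp.trans hLΩ)
    have hlhs : ∫ x in Ω, (N : ℝ)⁻¹ * fderiv ℝ (fun ξ => H ξ ^ N) (gradient u x) (gradient φ x) =
        ∫ x in Ω, r (u x) * H (gradient u x) ^ N := by
      refine setIntegral_congr_fun hΩo.measurableSet fun x hx => ?_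
      simp only [hgrad x hx, map_smul, finsler_euler hnorm hreg, smul_eq_mul]
      field_simp
    rw [hlhs] at htest
    have hint1 : IntegrableOn (fun x => u x ^ p * φ x) Ω := by
      obtain ⟨D, hD⟩ := hφc.exists_bound_of_continuous hφ1.continuous
      exact Integrable.mul_bdd (c := D) (hpow p (by linarith)) hφ1.continuous.aestronglyMeasurable
        (Filter.Eventually.of_forall hD)
    have hHnn : ∀ x, 0 ≤ H (gradient u x) ^ N := fun x => pow_nonneg (hnorm.2.1 _) _
    calc (∫ x in Ω, u x ^ (p + 1)) - 2 * ε * ∫ x in Ω, u x ^ p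
        = ∫ x in Ω, (u x ^ (p + 1) - 2 * ε * u x ^ p) := by
          rw [integral_sub (hpow _ (by linarith)) ((hpow p (by linarith)).const_mul _),
            integral_const_mul]
      _ ≤ ∫ x in Ω, u x ^ p * φ x := by
          refine setIntegral_mono_on ((hpow _ (by linarith)).sub
            ((hpow p (by linarith)).const_mul _)) hint1 hΩo.measurableSet fun x hx => ?_
          rw [show φ x = F (u x) from indicator_of_mem hx _, rpow_add_one (hpos x hx).ne',
            mul_comm (2 * ε), ← mul_sub]
          exact mul_le_mul_of_nonneg_left (hFl _) (rpow_nonneg (hpos x hx).le _)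
      _ = ∫ x in Ω, r (u x) * H (gradient u x) ^ N := htest.symm
      _ ≤ ∫ x in Ω, H (gradient u x) ^ N := by
          refine setIntegral_mono_on ?_ hHint hΩo.measurableSet fun x hx =>
            mul_le_of_le_one_left (hHnn x) (hr1 _)
          refine integrableOn_of_continuousOn_of_bounded hΩo hΩb
            ((hr.comp_continuousOn huΩ.continuousOn).mul hHcont) (C := C) fun x hx => ?_
          rw [abs_mul, abs_of_nonneg (hr0 _)]
          exact (mul_le_of_le_one_left (abs_nonneg _) (hr1 _)).trans (hHb x hx)
  have hlim : Tendsto (fun ε : ℝ => (∫ x in Ω, u x ^ (p + 1)) - 2 * ε * ∫ x in Ω, u x ^ p)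
      (𝓝[>] 0) (𝓝 (∫ x in Ω, u x ^ (p + 1))) := by
    have h : Continuous fun ε : ℝ => (∫ x in Ω, u x ^ (p + 1)) - 2 * ε * ∫ x in Ω, u x ^ p := by
      fun_prop
    have := h.tendsto 0
    simp only [mul_zero, zero_mul, sub_zero] at this
    exact this.mono_left nhdsWithin_le_nhds
  exact le_of_tendsto hlim (by filter_upwards [self_mem_nhdsWithin] with ε hε using key ε hε)

/-! ### Points have zero `N`-capacity -/

theorem norm_sum_pow_eq_of_pairwise {ι E : Type*} [NormedAddCommGroup E] {N : ℕ} (hN : N ≠ 0)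
    (s : Finset ι) (a : ι → E) (h : ∀ i ∈ s, ∀ j ∈ s, a i ≠ 0 → a j ≠ 0 → i = j) :
    ‖∑ i ∈ s, a i‖ ^ N = ∑ i ∈ s, ‖a i‖ ^ N := by
  by_cases h0 : ∃ i ∈ s, a i ≠ 0
  · obtain ⟨i, hi, hai⟩ := h0
    have hz : ∀ j ∈ s, j ≠ i → a j = 0 := fun j hj hji =>
      by_contra fun haj => hji (h j hj i hi haj hai)
    rw [Finset.sum_eq_single i hz (fun h' => absurd hi h'),
      Finset.sum_eq_single i (fun j hj hji => by rw [hz j hj hji, norm_zero, zero_pow hN])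
        (fun h' => absurd hi h')]
  · push Not at h0
    rw [Finset.sum_eq_zero h0, Finset.sum_eq_zero fun i hi => by rw [h0 i hi, norm_zero, zero_pow hN]]
    simp [hN]

theorem norm_mem_Ioo_of_fderiv_ne_zero {N : ℕ} (f : ContDiffBump (0 : Euc N)) {y : Euc N}
    (hy : fderiv ℝ f y ≠ 0) : f.rIn < ‖y‖ ∧ ‖y‖ < f.rOut := by
  constructor
  · by_contra! h
    have h1 : f y = 1 := f.one_of_mem_closedBall (by simpa using h)
    have hmax : IsLocalMax f y := Filter.Eventually.of_forall fun z => by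
      rw [h1]; exact f.le_one
    exact hy hmax.fderiv_eq_zero
  · by_contra! h
    have h1 : f y = 0 := f.zero_of_le_dist (by simpa using h)
    have hmin : IsLocalMin f y := Filter.Eventually.of_forall fun z => by
      rw [h1]; exact f.nonneg
    exact hy hmin.fderiv_eq_zero

/-- The average of `m` dyadic rescalings of a bump function has small `N`-energy, since the
gradients live on disjoint annuli. -/
theorem exists_test_function_small_energy {N : ℕ} (hN : 2 ≤ N) {H : Euc N → ℝ}
    (hnorm : IsFinslerNorm N H) (hcont : Continuous H) {Ω : Set (Euc N)} (hΩo : IsOpen Ω)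
    (hΩne : Ω.Nonempty) {δ : ℝ} (hδ : 0 < δ) :
    ∃ φ : Euc N → ℝ, ContDiff ℝ (⊤ : ℕ∞) φ ∧ HasCompactSupport φ ∧ tsupport φ ⊆ Ω ∧
      (∫ x in Ω, H (gradient φ x) ^ N) ≤ δ ∧
      ∃ x₀ : Euc N, ∃ ρ : ℝ, 0 < ρ ∧ Metric.ball x₀ ρ ⊆ Ω ∧ ∀ x ∈ Metric.ball x₀ ρ, φ x = 2 := by
  obtain ⟨x₀, hx₀⟩ := hΩne
  obtain ⟨R, hR, hball⟩ := Metric.isOpen_iff.1 hΩo x₀ hx₀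
  obtain ⟨C, hC0, hC⟩ := hnorm.exists_le_mul_norm hcont
  let f : ContDiffBump (0 : Euc N) := ⟨R / 4, R / 2, by positivity, by linarith⟩
  have hf : ContDiff ℝ (⊤ : ℕ∞) f := f.contDiff
  obtain ⟨B, hB⟩ := (f.hasCompactSupport.fderiv ℝ).exists_bound_of_continuous
    (hf.continuous_fderiv (by simp))
  have hB0 : 0 ≤ B := (norm_nonneg _).trans (hB 0)
  set V := volume.real (Metric.ball (0 : Euc N) 1) with hV
  have hV0 : 0 ≤ V := measureReal_nonneg
  set K := 2 * R * B * C with hK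
  have hK0 : 0 ≤ K := by positivity
  obtain ⟨m, hm⟩ := exists_nat_gt (max K (K ^ 2 * V / δ))
  have hmK : K < m := (le_max_left _ _).trans_lt hm
  have hmδ : K ^ 2 * V / δ < m := (le_max_right _ _).trans_lt hm
  have hm0 : (0 : ℝ) < m := hK0.trans_lt hmK
  let ψ : ℕ → Euc N → ℝ := fun k x => 2 / m * f ((2 : ℝ) ^ k • (x - x₀))
  let D : ℕ → Euc N → (Euc N →L[ℝ] ℝ) := fun k x =>
    (2 / m : ℝ) • ((2 : ℝ) ^ k • fderiv ℝ f ((2 : ℝ) ^ k • (x - x₀)))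
  have hψD : ∀ k x, HasFDerivAt (ψ k) (D k x) x := by
    intro k x
    have h1 : HasFDerivAt f (fderiv ℝ f ((2 : ℝ) ^ k • (x - x₀))) ((2 : ℝ) ^ k • (x - x₀)) :=
      (hf.differentiable (by simp) _).hasFDerivAt
    have h2 : HasFDerivAt (fun x : Euc N => (2 : ℝ) ^ k • (x - x₀))
        ((2 : ℝ) ^ k • ContinuousLinearMap.id ℝ (Euc N)) x :=
      ((hasFDerivAt_id x).sub_const x₀).const_smul ((2 : ℝ) ^ k)
    have h3 := (h1.comp x h2).const_mul (2 / m : ℝ)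
    rw [ContinuousLinearMap.comp_smul, ContinuousLinearMap.comp_id] at h3
    exact h3
  let φ : Euc N → ℝ := fun x => ∑ k ∈ Finset.range m, ψ k x
  have hφD : ∀ x, fderiv ℝ φ x = ∑ k ∈ Finset.range m, D k x := fun x =>
    (HasFDerivAt.fun_sum fun k _ => hψD k x).fderiv
  have hDne : ∀ k x, D k x ≠ 0 → R / 4 < 2 ^ k * ‖x - x₀‖ ∧ 2 ^ k * ‖x - x₀‖ < R / 2 := by
    intro k x hD
    have hne : fderiv ℝ f ((2 : ℝ) ^ k • (x - x₀)) ≠ 0 := fun h => hD (by simp [D, h])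
    have := norm_mem_Ioo_of_fderiv_ne_zero f hne
    rwa [norm_smul, Real.norm_of_nonneg (by positivity)] at this
  have hlt : ∀ k l x, D k x ≠ 0 → D l x ≠ 0 → ¬ k < l := by
    intro k l x hk hl hkl
    have h1 := (hDne k x hk).1
    have h2 := (hDne l x hl).2
    have h3 : (2 : ℝ) ^ (k + 1) ≤ 2 ^ l := pow_le_pow_right₀ one_le_two hkl
    have h4 := mul_le_mul_of_nonneg_right h3 (norm_nonneg (x - x₀))
    rw [pow_succ] at h4
    linarith
  have hDball : ∀ k x, ‖D k x‖ ^ N ≤ (Metric.ball x₀ (R / 2 ^ k)).indicator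
      (fun _ => (2 / m * (2 ^ k * B)) ^ N) x := by
    intro k x
    by_cases hD : D k x = 0
    · rw [hD, norm_zero, zero_pow (by lia)]
      exact indicator_nonneg (fun _ _ => by positivity) _
    · have hx : x ∈ Metric.ball x₀ (R / 2 ^ k) := by
        rw [mem_ball_iff_norm, lt_div_iff₀ (by positivity), mul_comm]
        linarith [(hDne k x hD).2]
      rw [indicator_of_mem hx]
      refine pow_le_pow_left₀ (norm_nonneg _) ?_ _
      rw [norm_smul, norm_smul, Real.norm_of_nonneg (by positivity),
        Real.norm_of_nonneg (by positivity)]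
      gcongr
      exact hB _
  have hsupp : Function.support φ ⊆ Metric.closedBall x₀ (R / 2) := by
    intro x hx
    obtain ⟨k, -, hk⟩ := Finset.exists_ne_zero_of_sum_ne_zero hx
    by_contra hxb
    rw [mem_closedBall_iff_norm, not_le] at hxb
    refine hk ?_
    have : f ((2 : ℝ) ^ k • (x - x₀)) = 0 := f.zero_of_le_dist (by
      rw [dist_zero_right, norm_smul, Real.norm_of_nonneg (by positivity)]
      exact hxb.le.trans (le_mul_of_one_le_left (norm_nonneg _) (one_le_pow₀ one_le_two)))
    simp [ψ, this]
  have htsupp : tsupport φ ⊆ Metric.closedBall x₀ (R / 2) :=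
    closure_minimal hsupp Metric.isClosed_closedBall
  refine ⟨φ, ?_, (isCompact_closedBall x₀ (R / 2)).of_isClosed_subset (isClosed_tsupport _) htsupp,
    htsupp.trans ((Metric.closedBall_subset_ball (by linarith)).trans hball), ?_,
    x₀, R / 4 / 2 ^ m, by positivity, ?_, ?_⟩
  · exact ContDiff.sum fun k _ => contDiff_const.mul (hf.comp (by fun_prop))
  · have hpt : ∀ x, H (gradient φ x) ^ N ≤ ∑ k ∈ Finset.range m,
        (Metric.ball x₀ (R / 2 ^ k)).indicator
          (fun _ => C ^ N * (2 / m * (2 ^ k * B)) ^ N) x := by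
      intro x
      calc H (gradient φ x) ^ N ≤ (C * ‖gradient φ x‖) ^ N :=
            pow_le_pow_left₀ (hnorm.2.1 _) (hC _) _
        _ = C ^ N * ∑ k ∈ Finset.range m, ‖D k x‖ ^ N := by
            rw [mul_pow, norm_gradient, hφD, norm_sum_pow_eq_of_pairwise (by lia)]
            intro i _ j _ hi hj
            exact le_antisymm (not_lt.1 (hlt j i x hj hi)) (not_lt.1 (hlt i j x hi hj))
        _ ≤ _ := by
            rw [Finset.mul_sum]
            refine Finset.sum_le_sum fun k _ => ?_
            refine (mul_le_mul_of_nonneg_left (hDball k x) (by positivity)).trans_eq ?_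
            by_cases hx : x ∈ Metric.ball x₀ (R / 2 ^ k)
            · rw [indicator_of_mem hx, indicator_of_mem hx]
            · rw [indicator_of_notMem hx, indicator_of_notMem hx, mul_zero]
    have hfin : ∀ k, volume.restrict Ω (Metric.ball x₀ (R / 2 ^ k)) ≠ ⊤ := fun k =>
      ((Measure.restrict_apply_le _ _).trans_lt measure_ball_lt_top).ne
    have hI : ∀ k ∈ Finset.range m, Integrable ((Metric.ball x₀ (R / 2 ^ k)).indicator
        (fun _ => C ^ N * (2 / m * (2 ^ k * B)) ^ N)) (volume.restrict Ω) := fun k _ =>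
      (integrable_indicator_iff Metric.isOpen_ball.measurableSet).2
        (integrableOn_const (hfin k))
    refine (integral_mono_of_nonneg (Filter.Eventually.of_forall fun x =>
      pow_nonneg (hnorm.2.1 _) _) (integrable_finsetSum _ hI)
      (Filter.Eventually.of_forall hpt)).trans ?_
    rw [integral_finsetSum _ hI]
    have hterm : ∀ k ∈ Finset.range m, ∫ x in Ω, (Metric.ball x₀ (R / 2 ^ k)).indicator
        (fun _ => C ^ N * (2 / m * (2 ^ k * B)) ^ N) x ≤ (K / m) ^ N * V := by
      intro k _
      rw [integral_indicator_const _ Metric.isOpen_ball.measurableSet, smul_eq_mul]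
      have hvol : (volume.restrict Ω).real (Metric.ball x₀ (R / 2 ^ k)) ≤ (R / 2 ^ k) ^ N * V := by
        refine (ENNReal.toReal_mono measure_ball_lt_top.ne
          (Measure.restrict_apply_le Ω (Metric.ball x₀ (R / 2 ^ k)))).trans_eq ?_
        rw [Measure.addHaar_ball_of_pos _ _ (by positivity), ENNReal.toReal_mul,
          ENNReal.toReal_ofReal (by positivity), finrank_euclideanSpace_fin]
        rfl
      refine (mul_le_mul_of_nonneg_right hvol (by positivity)).trans_eq ?_
      have : K / m = R / 2 ^ k * (C * (2 / m * (2 ^ k * B))) := by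
        rw [hK]; field_simp
      rw [this, mul_pow, mul_pow]
      ring
    refine (Finset.sum_le_sum hterm).trans ?_
    rw [Finset.sum_const, Finset.card_range, nsmul_eq_mul]
    have h1 : (K / m) ^ N ≤ (K / m) ^ 2 :=
      pow_le_pow_of_le_one (by positivity) ((div_le_one hm0).2 hmK.le) hN
    calc (m : ℝ) * ((K / m) ^ N * V) ≤ m * ((K / m) ^ 2 * V) := by gcongr
      _ = K ^ 2 * V / m := by field_simp
      _ ≤ δ := by
        rw [div_le_iff₀ hm0]
        rw [div_lt_iff₀ hδ] at hmδ
        linarith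
  · refine (Metric.ball_subset_ball ?_).trans hball
    calc R / 4 / 2 ^ m ≤ R / 4 := div_le_self (by positivity) (one_le_pow₀ one_le_two)
      _ ≤ R := by linarith
  · intro x hx
    have hone : ∀ k ∈ Finset.range m, ψ k x = 2 / m := by
      intro k hk
      have : f ((2 : ℝ) ^ k • (x - x₀)) = 1 := f.one_of_mem_closedBall (by
        rw [mem_closedBall_zero_iff, norm_smul, Real.norm_of_nonneg (by positivity)]
        rw [mem_ball_iff_norm, lt_div_iff₀ (by positivity)] at hx
        have h2 : (2 : ℝ) ^ k ≤ 2 ^ m :=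
          pow_le_pow_right₀ one_le_two (Finset.mem_range.1 hk).le
        have h3 := mul_le_mul_of_nonneg_right h2 (norm_nonneg (x - x₀))
        change _ ≤ R / 4
        linarith)
      simp [ψ, this]
    change ∑ k ∈ Finset.range m, ψ k x = 2
    rw [Finset.sum_congr rfl hone, Finset.sum_const, Finset.card_range, nsmul_eq_mul]
    field_simp

theorem energyInf_nonneg {N : ℕ} {H : Euc N → ℝ} (hnorm : IsFinslerNorm N H)
    (Ω : Set (Euc N)) (p : ℝ) : 0 ≤ energyInf N H Ω p := by
  refine Real.sInf_nonneg ?_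
  rintro c ⟨u, -, -, -, -, rfl⟩
  exact integral_nonneg fun x => pow_nonneg (hnorm.2.1 _) _

theorem tendsto_energyInf_zero {N : ℕ} (hN : 2 ≤ N) {H : Euc N → ℝ}
    (hnorm : IsFinslerNorm N H) (hcont : Continuous H) {Ω : Set (Euc N)} (hΩo : IsOpen Ω)
    (hΩne : Ω.Nonempty) : Tendsto (energyInf N H Ω) atTop (𝓝 0) := by
  refine tendsto_order.2 ⟨fun a ha => Filter.Eventually.of_forall fun p =>
    ha.trans_le (energyInf_nonneg hnorm Ω p), fun a ha => ?_⟩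
  obtain ⟨φ, hφ, hφc, hφs, hφE, x₀, ρ, hρ, hball, hφ2⟩ :=
    exists_test_function_small_energy hN hnorm hcont hΩo hΩne (half_pos ha)
  have hV : 0 < volume.real (Metric.ball x₀ ρ) :=
    ENNReal.toReal_pos (Metric.measure_ball_pos _ _ hρ).ne' measure_ball_lt_top.ne
  have hlarge : Tendsto (fun p : ℝ => (2 : ℝ) ^ (p + 1) * volume.real (Metric.ball x₀ ρ))
      atTop atTop :=
    ((tendsto_rpow_atTop_of_base_gt_one 2 one_lt_two).comp
      (tendsto_atTop_add_const_right _ 1 tendsto_id)).atTop_mul_const hV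
  filter_upwards [hlarge.eventually_ge_atTop 1, eventually_gt_atTop 0] with p hp hp0
  have hp1 : 0 < p + 1 := by linarith
  set s := ∫ x in Ω, |φ x| ^ (p + 1) with hs
  have hint : Integrable (fun x => |φ x| ^ (p + 1)) := by
    refine Continuous.integrable_of_hasCompactSupport
      (hφ.continuous.abs.rpow_const fun _ => Or.inr hp1.le) ?_
    exact hφc.comp_left (g := fun t => |t| ^ (p + 1)) (by simp [hp1.ne'])
  have hs1 : 1 ≤ s := by
    calc (1 : ℝ) ≤ 2 ^ (p + 1) * volume.real (Metric.ball x₀ ρ) := hp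
      _ = ∫ x in Metric.ball x₀ ρ, |φ x| ^ (p + 1) := by
        rw [setIntegral_congr_fun (g := fun _ => (2 : ℝ) ^ (p + 1))
          Metric.isOpen_ball.measurableSet fun x hx => by simp [hφ2 x hx]]
        rw [setIntegral_const, smul_eq_mul, mul_comm]
      _ ≤ s := setIntegral_mono_set hint.integrableOn
        (Filter.Eventually.of_forall fun x => rpow_nonneg (abs_nonneg _) _)
        (LE.le.eventuallyLE hball)
  have hs0 : 0 < s := by linarith
  set c := s ^ (-(p + 1)⁻¹) with hc
  have hc0 : 0 < c := rpow_pos_of_pos hs0 _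
  have hc1 : c ≤ 1 := rpow_le_one_of_one_le_of_nonpos hs1 (by simpa using hp1.le)
  have hcs : c ^ (p + 1) * s = 1 := by
    rw [hc, ← rpow_mul hs0.le, neg_mul, inv_mul_cancel₀ hp1.ne', rpow_neg_one,
      inv_mul_cancel₀ hs0.ne']
  have hgrad : ∀ x, gradient (fun x => c * φ x) x = c • gradient φ x := by
    intro x
    have hd : DifferentiableAt ℝ φ x := hφ.differentiable (by simp) x
    rw [gradient_eq_toDual_symm, (hd.hasFDerivAt.const_mul c).fderiv, map_smul,
      gradient_eq_toDual_symm]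
  have hmem : energyInf N H Ω p ≤ ∫ x in Ω, H (gradient (fun x => c * φ x) x) ^ N := by
    refine csInf_le ⟨0, ?_⟩ ⟨fun x => c * φ x, contDiff_const.mul hφ, hφc.mul_left,
      (tsupport_mul_subset_right (f := fun _ => c)).trans hφs, ?_, rfl⟩
    · rintro e ⟨u, -, -, -, -, rfl⟩
      exact integral_nonneg fun x => pow_nonneg (hnorm.2.1 _) _
    · simp_rw [abs_mul, abs_of_pos hc0, mul_rpow hc0.le (abs_nonneg _)]
      rw [integral_const_mul, hcs]
  refine hmem.trans_lt ?_
  simp_rw [hgrad, hnorm.2.2.2, abs_of_pos hc0, mul_pow]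
  rw [integral_const_mul]
  calc c ^ N * ∫ x in Ω, H (gradient φ x) ^ N ≤ 1 * ∫ x in Ω, H (gradient φ x) ^ N :=
        mul_le_mul_of_nonneg_right (pow_le_one₀ hc0.le hc1)
          (integral_nonneg fun x => pow_nonneg (hnorm.2.1 _) _)
    _ < a := by linarith

/-! ### Decay of the total mass -/

theorem le_of_le_mul_rpow {A c θ : ℝ} (hA : 0 < A) (hc : c < 1) (hθ0 : 0 ≤ θ) (hθ1 : θ < 1)
    (h : A ≤ c * A ^ θ) : A ≤ c := by
  have h1 : A ^ (1 - θ) ≤ c := by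
    rw [rpow_sub hA, rpow_one, div_le_iff₀ (rpow_pos_of_pos hA _)]
    exact h
  have hA1 : A ≤ 1 := by
    by_contra! hlt
    exact absurd (one_le_rpow hlt.le (by linarith : 0 ≤ 1 - θ)) (not_le.2 (h1.trans_lt hc))
  calc A = A ^ (1 : ℝ) := (rpow_one A).symm
    _ ≤ A ^ (1 - θ) := rpow_le_rpow_of_exponent_ge hA hA1 (by linarith)
    _ ≤ c := h1

theorem IsLeastEnergySolution.integrableOn_rpow {N : ℕ} {H : Euc N → ℝ} {Ω : Set (Euc N)}
    (hΩo : IsOpen Ω) (hΩb : Bornology.IsBounded Ω) {p : ℝ} {u : Euc N → ℝ}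
    (hu : IsLeastEnergySolution N H Ω p u) {q : ℝ} (hq : 0 ≤ q) :
    IntegrableOn (fun x => u x ^ q) Ω := by
  obtain ⟨M, hM⟩ := hΩb.isCompact_closure.exists_bound_of_continuousOn hu.1.continuousOn
  refine integrableOn_of_continuousOn_of_bounded hΩo hΩb (C := M ^ q)
    ((hu.1.continuousOn.mono subset_closure).rpow_const fun x hx => Or.inr hq) fun x hx => ?_
  rw [abs_of_nonneg (rpow_nonneg (hu.2.1 x hx).le _)]
  exact rpow_le_rpow (hu.2.1 x hx).le ((le_abs_self _).trans (hM x (subset_closure hx))) hq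

theorem IsLeastEnergySolution.integral_rpow_pos {N : ℕ} {H : Euc N → ℝ} {Ω : Set (Euc N)}
    (hΩo : IsOpen Ω) (hΩb : Bornology.IsBounded Ω) (hΩne : Ω.Nonempty) {p : ℝ} {u : Euc N → ℝ}
    (hu : IsLeastEnergySolution N H Ω p u) {q : ℝ} (hq : 0 ≤ q) :
    0 < ∫ x in Ω, u x ^ q := by
  rw [setIntegral_pos_iff_support_of_nonneg_ae
    ((ae_restrict_iff' hΩo.measurableSet).2 (Filter.Eventually.of_forall fun x hx =>
      rpow_nonneg (hu.2.1 x hx).le _)) (hu.integrableOn_rpow hΩo hΩb hq)]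
  refine (hΩo.measure_pos volume hΩne).trans_le (measure_mono fun x hx => ⟨?_, hx⟩)
  exact (rpow_pos_of_pos (hu.2.1 x hx) _).ne'

theorem IsLeastEnergySolution.integral_rpow_add_one_le {N : ℕ} (hN : 2 ≤ N) {H : Euc N → ℝ}
    (hnorm : IsFinslerNorm N H) (hreg : FinslerRegular N H) {Ω : Set (Euc N)} (hΩo : IsOpen Ω)
    (hΩb : Bornology.IsBounded Ω) (hΩne : Ω.Nonempty) {p : ℝ} (hp : 1 < p) (hpN : (N : ℝ) < p + 1)
    {u : Euc N → ℝ} (hu : IsLeastEnergySolution N H Ω p u) (hC : energyInf N H Ω p < 1) :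
    ∫ x in Ω, u x ^ (p + 1) ≤ energyInf N H Ω p := by
  refine le_of_le_mul_rpow (hu.integral_rpow_pos hΩo hΩb hΩne (by linarith)) hC
    (θ := (N : ℝ) / (p + 1)) (by positivity) ((div_lt_one (by linarith)).2 hpN) ?_
  rw [← hu.2.2.2.2]
  exact integral_rpow_le_energy hN hnorm hreg hΩo hΩb hp hu.1 hu.2.1 hu.2.2.1 hu.2.2.2.1

theorem IsLeastEnergySolution.integral_rpow_le {N : ℕ} {H : Euc N → ℝ} {Ω : Set (Euc N)}
    (hΩo : IsOpen Ω) (hΩb : Bornology.IsBounded Ω) {p : ℝ} (hp : 1 < p) {u : Euc N → ℝ}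
    (hu : IsLeastEnergySolution N H Ω p u) {η : ℝ} (hη : 0 < η) (hη1 : η ≤ 1) :
    ∫ x in Ω, u x ^ p ≤ η⁻¹ * (∫ x in Ω, u x ^ (p + 1)) + η * volume.real Ω := by
  have hi1 := hu.integrableOn_rpow hΩo hΩb (q := p) (by linarith)
  have hi2 := hu.integrableOn_rpow hΩo hΩb (q := p + 1) (by linarith)
  have hi3 : IntegrableOn (fun _ : Euc N => η) Ω := integrableOn_const hΩb.measure_lt_top.ne
  calc ∫ x in Ω, u x ^ p ≤ ∫ x in Ω, (η⁻¹ * u x ^ (p + 1) + η) := by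
        refine setIntegral_mono_on hi1 ((hi2.const_mul _).add hi3) hΩo.measurableSet
          fun x hx => ?_
        have hux := hu.2.1 x hx
        have hup := rpow_nonneg hux.le p
        rw [rpow_add_one hux.ne']
        rcases le_total η (u x) with h | h
        · have : 1 ≤ η⁻¹ * u x := by rwa [inv_mul_eq_div, one_le_div hη]
          calc u x ^ p ≤ u x ^ p * (η⁻¹ * u x) := le_mul_of_one_le_right hup this
            _ ≤ η⁻¹ * (u x ^ p * u x) + η := by linarith
        · have h1 : u x ^ p ≤ η := calc
            u x ^ p ≤ u x ^ (1 : ℝ) :=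
              rpow_le_rpow_of_exponent_ge hux (h.trans hη1) hp.le
            _ ≤ η := by rwa [rpow_one]
          have : 0 ≤ η⁻¹ * (u x ^ p * u x) := by positivity
          linarith
    _ = η⁻¹ * (∫ x in Ω, u x ^ (p + 1)) + η * volume.real Ω := by
        rw [integral_add (hi2.const_mul _) hi3, integral_const_mul, setIntegral_const,
          smul_eq_mul, mul_comm (volume.real Ω)]

theorem tendsto_integral_rpow_zero {N : ℕ} (hN : 2 ≤ N) {H : Euc N → ℝ}
    (hnorm : IsFinslerNorm N H) (hreg : FinslerRegular N H) {Ω : Set (Euc N)} (hΩo : IsOpen Ω)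
    (hΩb : Bornology.IsBounded Ω) (hΩne : Ω.Nonempty) {p : ℕ → ℝ} (hp : ∀ n, 1 < p n)
    (hptop : Tendsto p atTop atTop) {u : ℕ → Euc N → ℝ}
    (hu : ∀ n, IsLeastEnergySolution N H Ω (p n) (u n)) :
    Tendsto (fun n => ∫ x in Ω, u n x ^ p n) atTop (𝓝 0) := by
  have hC : Tendsto (fun n => energyInf N H Ω (p n)) atTop (𝓝 0) :=
    (tendsto_energyInf_zero hN hnorm (hreg.continuous (by lia) hnorm) hΩo hΩne).comp hptop
  refine tendsto_order.2 ⟨fun a ha => Filter.Eventually.of_forall fun n =>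
    ha.trans ((hu n).integral_rpow_pos hΩo hΩb hΩne (by linarith [hp n])), fun a ha => ?_⟩
  set W := volume.real Ω with hW
  have hW0 : 0 ≤ W := measureReal_nonneg
  set η := min 1 (a / (2 * (W + 1))) with hηdef
  have hη : 0 < η := lt_min one_pos (by positivity)
  have hηW : η * W < a / 2 + a / 4 := by
    have h1 : η * (W + 1) ≤ a / 2 := by
      calc η * (W + 1) ≤ a / (2 * (W + 1)) * (W + 1) := by
            gcongr; exact min_le_right _ _
        _ = a / 2 := by field_simp
    nlinarith
  have hsmall : ∀ᶠ n in atTop, energyInf N H Ω (p n) < min 1 (η * (a / 4)) :=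
    (tendsto_order.1 hC).2 _ (lt_min one_pos (by positivity))
  filter_upwards [hsmall, hptop.eventually_gt_atTop (N : ℝ)] with n hn hpn
  have h1 := (hu n).integral_rpow_add_one_le hN hnorm hreg hΩo hΩb hΩne (hp n) (by linarith)
    (hn.trans_le (min_le_left _ _))
  have h2 := (hu n).integral_rpow_le hΩo hΩb (hp n) hη (min_le_left _ _)
  have h3 : η⁻¹ * (∫ x in Ω, u n x ^ (p n + 1)) < a / 4 := by
    rw [inv_mul_lt_iff₀ hη]
    exact (h1.trans_lt hn).trans_le (min_le_right _ _)
  linarith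

/-- Away from the (finite, interior) blow-up set the solutions tend to `0` uniformly
on compact sets (Theorem 1.3 (iii)). -/
theorem uniform_convergence_to_zero (N : ℕ) (hN : 2 ≤ N) (H : Euc N → ℝ)
    (hnorm : IsFinslerNorm N H) (hreg : FinslerRegular N H)
    (Ω : Set (Euc N)) (hΩo : IsOpen Ω) (hΩb : Bornology.IsBounded Ω) (hΩne : Ω.Nonempty)
    (p : ℕ → ℝ) (hp : ∀ n, 1 < p n) (hptop : Tendsto p atTop atTop)
    (u : ℕ → Euc N → ℝ) (hu : ∀ n, IsLeastEnergySolution N H Ω (p n) (u n))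
    (v : ℕ → Euc N → ℝ)
    (hv : ∀ n x, v n x = u n x / (∫ y in Ω, u n y ^ p n) ^ (1 / ((N : ℝ) - 1)))
    (T : Finset (Euc N)) (hS : BlowUpSet Ω v ∩ Ω = (T : Set (Euc N))) :
    ∀ K : Set (Euc N), IsCompact K → K ⊆ Ω \ (T : Set (Euc N)) →
      Tendsto (fun n => sSup ((fun x => |u n x|) '' K)) atTop (𝓝 0) := by
  intro K hK hKsub
  have hI := tendsto_integral_rpow_zero hN hnorm hreg hΩo hΩb hΩne hp hptop hu
  have hIpos : ∀ n, 0 < ∫ y in Ω, u n y ^ p n := fun n =>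
    (hu n).integral_rpow_pos hΩo hΩb hΩne (by linarith [hp n])
  have hN1 : (0 : ℝ) < (N : ℝ) - 1 := by
    have : (2 : ℝ) ≤ N := by exact_mod_cast hN
    linarith
  have he : 0 < 1 / ((N : ℝ) - 1) := one_div_pos.2 hN1
  have hJ : Tendsto (fun n => (∫ y in Ω, u n y ^ p n) ^ (1 / ((N : ℝ) - 1))) atTop (𝓝 0) := by
    have := hI.rpow_const (p := 1 / ((N : ℝ) - 1)) (Or.inr he.le)
    rwa [zero_rpow he.ne'] at this
  have hJinv : Tendsto (fun n => ((∫ y in Ω, u n y ^ p n) ^ (1 / ((N : ℝ) - 1)))⁻¹)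
      atTop atTop :=
    (tendsto_nhdsWithin_iff.2 ⟨hJ, Filter.Eventually.of_forall fun n =>
      rpow_pos_of_pos (hIpos n) _⟩).inv_tendsto_nhdsGT_zero
  have hKΩ : ∀ x ∈ K, x ∈ Ω := fun x hx => (hKsub hx).1
  refine tendsto_order.2 ⟨fun a ha => Filter.Eventually.of_forall fun n => ha.trans_le
    (Real.sSup_nonneg (by rintro _ ⟨x, -, rfl⟩; exact abs_nonneg _)), fun a ha => ?_⟩
  by_contra hcon
  have hfreq : ∃ᶠ n in atTop, ∃ x ∈ K, a / 2 < u n x := by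
    refine (Filter.not_eventually.1 hcon).mono fun n hn => ?_
    by_contra! hle
    refine hn ((Real.sSup_le ?_ (half_pos ha).le).trans_lt (half_lt_self ha))
    rintro _ ⟨x, hx, rfl⟩
    exact (abs_of_pos ((hu n).2.1 x (hKΩ x hx))).trans_le (hle x hx)
  obtain ⟨σ, hσ, hσx⟩ := extraction_of_frequently_atTop hfreq
  choose xs hxsK hxs using hσx
  obtain ⟨x, hxK, τ, hτ, hxlim⟩ := hK.tendsto_subseq hxsK
  have hblow : x ∈ BlowUpSet Ω v := by
    refine ⟨subset_closure (hKΩ x hxK), σ ∘ τ, hσ.comp hτ, xs ∘ τ, fun n => hKΩ _ (hxsK _), hxlim,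
      ?_⟩
    refine tendsto_atTop_mono (fun n => ?_) ((hJinv.comp
      (hσ.comp hτ).tendsto_atTop).const_mul_atTop (half_pos ha))
    rw [hv, div_eq_mul_inv]
    exact mul_le_mul_of_nonneg_right (hxs (τ n)).le
      (inv_nonneg.2 (rpow_nonneg (hIpos _).le _))
  exact (hKsub hxK).2 (hS ▸ ⟨hblow, hKΩ x hxK⟩)
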